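/- arXiv:2210.10029 — 2 statements merged into one kernel-verified Lean document; each statement's English description precedes it below -/
import Mathlib

section
/- Let d ≥ 1, λ > 0, α > 0, and assume ĝ_α(t) > 0 for every t ∈ ℝ^d with |t| ≤ √d·λ (this is equivalent to 2π√d·αλ being smaller than the first positive zero of the Bessel function J_{d/2}). Then for every measurable set N ⊆ ℝ^d and every G in the Paley–Wiener space B¹([-λ,λ]^d), ∫_N |G(x)| dx ≤ (1/ĝ_α((λ,…,λ))) · (sup_{x∈ℝ^d} |N ∩ B(x,α)|) · ‖G‖_{L¹(ℝ^d)}, where B(x,α) is the closed Euclidean ball of radius α centered at x, (λ,…,λ) is the corner of the cube [-λ,λ]^d, and |·| denotes Lebesgue measure on ℝ^d. -/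
open MeasureTheory Real Set FourierTransform
open scoped RealInnerProductSpace

/-- `ĝ_α(t) = ∫_{B(0,α)} e^{-2πi⟨x,t⟩} dx`, the Fourier transform of the indicator of the
closed Euclidean ball of radius `α` in `ℝ^d`.  Since the ball is symmetric, this is the
real-valued cosine integral below, which we take as the definition. -/
noncomputable def ghatBall (d : ℕ) (α : ℝ) (t : EuclideanSpace ℝ (Fin d)) : ℝ :=
  ∫ x in Metric.closedBall (0 : EuclideanSpace ℝ (Fin d)) α, Real.cos (2 * π * ⟪x, t⟫)

/-- The cube `[-λ, λ]^d` in `ℝ^d`. -/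
def cube (d : ℕ) (lam : ℝ) : Set (EuclideanSpace ℝ (Fin d)) :=
  {t | ∀ i, |t i| ≤ lam}

/-- The corner `(λ, …, λ)` of the cube `[-λ, λ]^d`. -/
noncomputable def corner (d : ℕ) (lam : ℝ) : EuclideanSpace ℝ (Fin d) :=
  (EuclideanSpace.equiv (Fin d) ℝ).symm (fun _ => lam)

/-- The Paley–Wiener space `B¹([-λ,λ]^d)`: integrable functions on `ℝ^d` whose
(distributional) Fourier transform — which for `L¹` functions is the continuous function
`𝓕 G ξ = ∫ x, G x * exp (-2πi⟨x,ξ⟩)` — is supported in the cube `[-λ,λ]^d`. -/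
def PaleyWienerCube (d : ℕ) (lam : ℝ) (G : EuclideanSpace ℝ (Fin d) → ℂ) : Prop :=
  Integrable G ∧ ∀ t : EuclideanSpace ℝ (Fin d), t ∉ cube d lam → 𝓕 G t = 0

section EntireSeries

lemma norm_natCast_mul_mul_pow_pred_le {e y R : ℝ} (hR : 1 ≤ R) (hy : |y| ≤ R) (n : ℕ) :
    ‖(n : ℝ) * e * y ^ (n - 1)‖ ≤ |e| * (2 * R) ^ n := by
  have h2 : (n : ℝ) ≤ 2 ^ n := by exact_mod_cast n.lt_two_pow_self.le
  have h3 : |y| ^ (n - 1) ≤ R ^ n :=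
    (pow_le_pow_left₀ (abs_nonneg _) hy _).trans (pow_le_pow_right₀ hR (Nat.sub_le _ _))
  rw [norm_mul, norm_mul, norm_pow, Real.norm_natCast, Real.norm_eq_abs, Real.norm_eq_abs, mul_pow]
  calc (n : ℝ) * |e| * |y| ^ (n - 1) ≤ 2 ^ n * |e| * R ^ n := by gcongr
    _ = |e| * (2 ^ n * R ^ n) := by ring

lemma summable_mul_pow {e : ℕ → ℝ} (he : ∀ r : ℝ, 0 ≤ r → Summable fun n ↦ |e n| * r ^ n)
    (s : ℝ) : Summable fun n ↦ e n * s ^ n := by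
  refine Summable.of_norm ?_
  simpa [abs_mul, abs_pow] using he |s| (abs_nonneg s)

lemma summable_natCast_mul_mul_pow_pred {e : ℕ → ℝ}
    (he : ∀ r : ℝ, 0 ≤ r → Summable fun n ↦ |e n| * r ^ n) (s : ℝ) :
    Summable fun n : ℕ ↦ (n : ℝ) * e n * s ^ (n - 1) :=
  Summable.of_norm_bounded (he (2 * (|s| + 1)) (by positivity)) fun n ↦
    norm_natCast_mul_mul_pow_pred_le (by linarith [abs_nonneg s]) (by linarith) n

lemma hasDerivAt_tsum_mul_pow {e : ℕ → ℝ}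
    (he : ∀ r : ℝ, 0 ≤ r → Summable fun n ↦ |e n| * r ^ n) (s : ℝ) :
    HasDerivAt (fun x ↦ ∑' n, e n * x ^ n) (∑' n : ℕ, (n : ℝ) * e n * s ^ (n - 1)) s := by
  have hs : s ∈ Metric.ball (0 : ℝ) (|s| + 1) := by simp
  refine hasDerivAt_tsum_of_isPreconnected (g := fun n x ↦ e n * x ^ n)
    (g' := fun n x ↦ (n : ℝ) * e n * x ^ (n - 1))
    (he (2 * (|s| + 1)) (by positivity)) Metric.isOpen_ball
    (convex_ball _ _).isPreconnected (fun n y _ ↦ ?_) (fun n y hy ↦ ?_) hs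
    (summable_mul_pow he s) hs
  · exact ((hasDerivAt_pow n y).const_mul (e n)).congr_deriv (by ring)
  · refine norm_natCast_mul_mul_pow_pred_le (by linarith [abs_nonneg s]) ?_ n
    rw [mem_ball_zero_iff, Real.norm_eq_abs] at hy
    exact hy.le

end EntireSeries

section ReciprocalSeries

open Finset.HasAntidiagonal (antidiagonal) in
lemma sum_range_antidiagonal_mul_le {u v : ℕ → ℝ} (hu : ∀ n, 0 ≤ u n) (hv : ∀ n, 0 ≤ v n)
    (N : ℕ) : ∑ n ∈ Finset.range N, ∑ ij ∈ antidiagonal n, u ij.1 * v ij.2 ≤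
      (∑ n ∈ Finset.range N, u n) * ∑ n ∈ Finset.range N, v n := by
  rw [Finset.sum_sigma', Finset.sum_mul_sum, ← Finset.sum_product']
  rw [← Finset.sum_image (f := fun x : ℕ × ℕ ↦ u x.1 * v x.2)
    (g := fun x : (_ : ℕ) × (ℕ × ℕ) ↦ x.2)]
  · refine Finset.sum_le_sum_of_subset_of_nonneg ?_ fun x _ _ ↦ mul_nonneg (hu _) (hv _)
    intro x hx
    simp only [Finset.mem_image, Finset.mem_sigma, Finset.mem_range,
      Finset.HasAntidiagonal.mem_antidiagonal] at hx
    obtain ⟨⟨n, y⟩, ⟨h1, h2⟩, rfl⟩ := hx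
    simp only [Finset.mem_product, Finset.mem_range]
    dsimp only at h1 h2 ⊢
    omega
  · rintro ⟨n, x⟩ hx ⟨m, y⟩ hy h
    simp only [Finset.coe_sigma, Set.mem_sigma_iff, Finset.mem_coe,
      Finset.HasAntidiagonal.mem_antidiagonal] at hx hy h
    subst h
    simp [← hx.2, ← hy.2]

/-- If `X Ψ' + a Ψ = c Φ` with `Φ' = -Ψ`, then the quotient `W = Ψ / Φ` solves a Riccati equation
with nonnegative data. -/
lemma riccati_of_linear {a c : ℝ} {Φ Ψ : PowerSeries ℝ} (h0 : PowerSeries.constantCoeff Φ ≠ 0)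
    (h1 : PowerSeries.derivative ℝ Φ = -Ψ)
    (h2 : PowerSeries.X * PowerSeries.derivative ℝ Ψ + PowerSeries.C a * Ψ = PowerSeries.C c * Φ) :
    PowerSeries.X * PowerSeries.derivative ℝ (Ψ * Φ⁻¹) + PowerSeries.C a * (Ψ * Φ⁻¹) =
      PowerSeries.C c + PowerSeries.X * (Ψ * Φ⁻¹) ^ 2 := by
  have h3 := PowerSeries.mul_inv_cancel Φ h0
  rw [Derivation.leibniz, PowerSeries.derivative_inv', h1]
  simp only [smul_eq_mul]
  linear_combination Φ⁻¹ * h2 + PowerSeries.C c * h3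

open Finset.HasAntidiagonal (antidiagonal)

lemma riccati_coeff_succ {a c : ℝ} {W : PowerSeries ℝ}
    (hW : PowerSeries.X * PowerSeries.derivative ℝ W + PowerSeries.C a * W =
      PowerSeries.C c + PowerSeries.X * W ^ 2) (n : ℕ) :
    (n + 1 + a) * PowerSeries.coeff (n + 1) W = PowerSeries.coeff n (W * W) := by
  have h := congrArg (PowerSeries.coeff (n + 1)) hW
  simp only [map_add, PowerSeries.coeff_succ_X_mul, PowerSeries.coeff_derivative,
    PowerSeries.coeff_C_mul, PowerSeries.coeff_C, Nat.succ_ne_zero, if_false, zero_add,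
    pow_two] at h
  linarith

lemma coeff_nonneg_of_riccati {a c : ℝ} (ha : 0 < a) (hc : 0 ≤ c) {W : PowerSeries ℝ}
    (hW : PowerSeries.X * PowerSeries.derivative ℝ W + PowerSeries.C a * W =
      PowerSeries.C c + PowerSeries.X * W ^ 2) (n : ℕ) : 0 ≤ PowerSeries.coeff n W := by
  induction n using Nat.strong_induction_on with
  | _ n ih =>
  rcases n with _ | n
  · have h := congrArg (PowerSeries.coeff 0) hW
    simp at h
    exact le_of_mul_le_mul_left (by simpa [h] using hc) ha
  · have h := riccati_coeff_succ hW n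
    rw [PowerSeries.coeff_mul] at h
    have h1 : 0 ≤ ∑ p ∈ antidiagonal n, PowerSeries.coeff p.1 W * PowerSeries.coeff p.2 W := by
      refine Finset.sum_nonneg fun p hp ↦ ?_
      rw [Finset.HasAntidiagonal.mem_antidiagonal] at hp
      exact mul_nonneg (ih _ (by omega)) (ih _ (by omega))
    refine nonneg_of_mul_nonneg_right (a := (n + 1 + a : ℝ)) ?_ (by positivity)
    linarith

lemma coeff_nonneg_of_derivative_eq_mul {P W : PowerSeries ℝ}
    (hW : ∀ n, 0 ≤ PowerSeries.coeff n W) (h0 : 0 ≤ PowerSeries.constantCoeff P)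
    (hP : PowerSeries.derivative ℝ P = W * P) (n : ℕ) : 0 ≤ PowerSeries.coeff n P := by
  induction n using Nat.strong_induction_on with
  | _ n ih =>
  rcases n with _ | n
  · simpa using h0
  · have h := congrArg (PowerSeries.coeff n) hP
    rw [PowerSeries.coeff_derivative, PowerSeries.coeff_mul] at h
    have h1 : 0 ≤ ∑ p ∈ antidiagonal n, PowerSeries.coeff p.1 W * PowerSeries.coeff p.2 P := by
      refine Finset.sum_nonneg fun p hp ↦ ?_
      rw [Finset.HasAntidiagonal.mem_antidiagonal] at hp
      exact mul_nonneg (hW _) (ih _ (by omega))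
    refine nonneg_of_mul_nonneg_left (b := (n + 1 : ℝ)) ?_ (by positivity)
    linarith

lemma sum_range_coeff_mul_mul_pow_le {U V : PowerSeries ℝ} (hU : ∀ n, 0 ≤ PowerSeries.coeff n U)
    (hV : ∀ n, 0 ≤ PowerSeries.coeff n V) {s : ℝ} (hs : 0 ≤ s) (N : ℕ) :
    ∑ n ∈ Finset.range N, PowerSeries.coeff n (U * V) * s ^ n ≤
      (∑ n ∈ Finset.range N, PowerSeries.coeff n U * s ^ n) *
        ∑ n ∈ Finset.range N, PowerSeries.coeff n V * s ^ n := by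
  refine le_trans (le_of_eq ?_) (sum_range_antidiagonal_mul_le
    (fun n ↦ mul_nonneg (hU n) (pow_nonneg hs n)) (fun n ↦ mul_nonneg (hV n) (pow_nonneg hs n)) N)
  refine Finset.sum_congr rfl fun n _ ↦ ?_
  rw [PowerSeries.coeff_mul, Finset.sum_mul]
  refine Finset.sum_congr rfl fun p hp ↦ ?_
  rw [Finset.HasAntidiagonal.mem_antidiagonal] at hp
  rw [← hp, pow_add]
  ring

/-- Partial sums of a power series solution of the Riccati equation are subsolutions. -/
lemma sum_range_riccati_le {a c : ℝ} {W : PowerSeries ℝ} (hW0 : ∀ n, 0 ≤ PowerSeries.coeff n W)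
    (hW : PowerSeries.X * PowerSeries.derivative ℝ W + PowerSeries.C a * W =
      PowerSeries.C c + PowerSeries.X * W ^ 2) {s : ℝ} (hs : 0 ≤ s) (N : ℕ) :
    ∑ n ∈ Finset.range (N + 1), (n + a) * PowerSeries.coeff n W * s ^ n ≤
      c + s * (∑ n ∈ Finset.range (N + 1), PowerSeries.coeff n W * s ^ n) ^ 2 := by
  have h0 : a * PowerSeries.coeff 0 W = c := by
    simpa using congrArg (PowerSeries.coeff 0) hW
  rw [Finset.sum_range_succ']
  have h2 : ∑ n ∈ Finset.range N, ((n + 1 : ℕ) + a) * PowerSeries.coeff (n + 1) W * s ^ (n + 1) =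
      s * ∑ n ∈ Finset.range N, PowerSeries.coeff n (W * W) * s ^ n := by
    rw [Finset.mul_sum]
    refine Finset.sum_congr rfl fun n _ ↦ ?_
    rw [← riccati_coeff_succ hW]
    push_cast
    ring
  have h3 := sum_range_coeff_mul_mul_pow_le hW0 hW0 hs N
  have h4 : ∑ n ∈ Finset.range N, PowerSeries.coeff n W * s ^ n ≤
      ∑ n ∈ Finset.range (N + 1), PowerSeries.coeff n W * s ^ n := by
    rw [Finset.sum_range_succ]
    linarith [mul_nonneg (hW0 N) (pow_nonneg hs N)]
  have h5 : 0 ≤ ∑ n ∈ Finset.range N, PowerSeries.coeff n W * s ^ n :=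
    Finset.sum_nonneg fun n _ ↦ mul_nonneg (hW0 n) (pow_nonneg hs n)
  rw [h2]
  have h6 := mul_le_mul_of_nonneg_left (h3.trans (mul_le_mul h4 h4 h5 (h5.trans h4))) hs
  rw [pow_two]
  push_cast
  linarith

lemma hasDerivAt_sum_range_mul_pow (e : ℕ → ℝ) (N : ℕ) (s : ℝ) :
    HasDerivAt (fun x ↦ ∑ n ∈ Finset.range N, e n * x ^ n)
      (∑ n ∈ Finset.range N, (n : ℝ) * e n * s ^ (n - 1)) s :=
  HasDerivAt.fun_sum fun n _ ↦ ((hasDerivAt_pow n s).const_mul (e n)).congr_deriv (by ring)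

lemma nonneg_of_sub_mul_le_mul_deriv {a s₀ : ℝ} (ha : 0 < a) {D D' W : ℝ → ℝ}
    (hD : ∀ s, HasDerivAt D (D' s) s) (hW : Continuous W)
    (h : ∀ s ∈ Ioo 0 s₀, (s * W s - a) * D s ≤ s * D' s) {s : ℝ} (hs : s ∈ Ioc 0 s₀) :
    0 ≤ D s := by
  set V : ℝ → ℝ := fun s ↦ ∫ t in (0 : ℝ)..s, W t
  have hV (s : ℝ) : HasDerivAt V (W s) s := (hW.integral_hasStrictDerivAt 0 s).hasDerivAt
  have hcont : Continuous fun s ↦ s ^ a * (rexp (-V s) * D s) := by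
    have h1 : Continuous V := continuous_iff_continuousAt.2 fun s ↦ (hV s).continuousAt
    have h2 : Continuous D := continuous_iff_continuousAt.2 fun s ↦ (hD s).continuousAt
    have h3 : Continuous fun s : ℝ ↦ s ^ a := Real.continuous_rpow_const ha.le
    fun_prop
  have hmono : MonotoneOn (fun s ↦ s ^ a * (rexp (-V s) * D s)) (Icc 0 s₀) := by
    refine monotoneOn_of_hasDerivWithinAt_nonneg (convex_Icc 0 s₀) hcont.continuousOn
      (f' := fun s ↦ s ^ (a - 1) * (rexp (-V s) * (s * D' s - (s * W s - a) * D s)))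
      (fun s hs ↦ ?_) fun s hs ↦ ?_
    · rw [interior_Icc] at hs
      have h1 : HasDerivAt (fun s : ℝ ↦ s ^ a) (a * s ^ (a - 1)) s :=
        Real.hasDerivAt_rpow_const (Or.inl hs.1.ne')
      refine ((h1.mul ((hV s).neg.exp.mul (hD s))).congr_deriv ?_).hasDerivWithinAt
      have h2 : s ^ a = s ^ (a - 1) * s := by
        rw [← Real.rpow_add_one hs.1.ne', sub_add_cancel]
      simp only [h2, Pi.mul_apply, Pi.neg_apply]
      ring
    · rw [interior_Icc] at hs
      have := h s hs
      have h3 : 0 ≤ s ^ (a - 1) := Real.rpow_nonneg hs.1.le _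
      exact mul_nonneg h3 (mul_nonneg (Real.exp_pos _).le (by linarith))
  have h0 := hmono (left_mem_Icc.2 (hs.1.le.trans hs.2)) ⟨hs.1.le, hs.2⟩ hs.1.le
  simp only [Real.zero_rpow ha.ne', zero_mul] at h0
  have h4 : 0 < s ^ a := Real.rpow_pos_of_pos hs.1 a
  exact nonneg_of_mul_nonneg_right (nonneg_of_mul_nonneg_right h0 h4) (Real.exp_pos _)

/-- Let `φ(s) = ∑ (-1)ⁿ βₙ sⁿ` be the entire function with `s φ'' + a φ' + c φ = 0`.  On any
interval `[0, s₀]` where `φ > 0`, its reciprocal is the sum of a power series with nonnegative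
coefficients. -/
theorem exists_hasSum_inv_of_recurrence {a c s₀ : ℝ} (ha : 0 < a) (hc : 0 < c) {β : ℕ → ℝ}
    (hβ0 : 0 < β 0) (hβ : ∀ n : ℕ, (n + 1) * (n + a) * β (n + 1) = c * β n)
    (hpos : ∀ s ∈ Icc 0 s₀, 0 < ∑' n, (-1) ^ n * β n * s ^ n) :
    ∃ p : ℕ → ℝ, (∀ n, 0 ≤ p n) ∧
      ∀ s ∈ Icc 0 s₀, HasSum (fun n ↦ p n * s ^ n) (∑' n, (-1) ^ n * β n * s ^ n)⁻¹ := by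
  have hβpos (n : ℕ) : 0 < β n := by
    induction n with
    | zero => exact hβ0
    | succ n ih =>
      refine pos_of_mul_pos_right (a := (n + 1) * (n + a)) ?_ (by positivity)
      rw [hβ]
      positivity
  have hβs (r : ℝ) (hr : 0 ≤ r) : Summable fun n ↦ β n * r ^ n := by
    refine summable_of_ratio_norm_eventually_le (r := 1 / 2) (by norm_num) ?_
    have h1 : Filter.Tendsto (fun n : ℕ ↦ ((n : ℝ) + 1)⁻¹ * (c * r / a)) Filter.atTop (nhds 0) := by
      have := tendsto_one_div_add_atTop_nhds_zero_nat (𝕜 := ℝ)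
      simpa using this.mul_const (c * r / a)
    filter_upwards [h1.eventually (gt_mem_nhds (show (0 : ℝ) < 1 / 2 by norm_num))] with n hn
    rw [Real.norm_of_nonneg (by have := hβpos (n + 1); positivity),
      Real.norm_of_nonneg (by have := hβpos n; positivity)]
    have h2 : β (n + 1) = c * β n / ((n + 1) * (n + a)) := by
      rw [← hβ]
      field_simp
    have h3 : c * r / ((n + 1) * (n + a)) ≤ 1 / 2 := by
      refine le_trans ?_ hn.le
      rw [inv_mul_eq_div, div_div, mul_comm (n + 1 : ℝ)]
      gcongr
      · simp
    calc β (n + 1) * r ^ (n + 1) = (c * r / ((n + 1) * (n + a))) * (β n * r ^ n) := by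
          rw [h2]; ring
      _ ≤ 1 / 2 * (β n * r ^ n) := by
          have := hβpos n
          gcongr
  set e : ℕ → ℝ := fun n ↦ (-1) ^ n * β n with he_def
  set f : ℕ → ℝ := fun n ↦ -((n + 1) * e (n + 1)) with hf_def
  have hef (n : ℕ) : (n + a) * f n = c * e n := by
    simp only [he_def, hf_def]
    linear_combination (-1) ^ n * hβ n
  have he (r : ℝ) (hr : 0 ≤ r) : Summable fun n ↦ |e n| * r ^ n := by
    refine (hβs r hr).congr fun n ↦ ?_
    simp [he_def, abs_mul, abs_of_pos (hβpos n)]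
  have hf (r : ℝ) (hr : 0 ≤ r) : Summable fun n ↦ |f n| * r ^ n := by
    refine Summable.of_nonneg_of_le (fun n ↦ by positivity) (fun n ↦ ?_)
      ((he r hr).mul_left (c / a))
    have h1 : |f n| ≤ c / a * |e n| := by
      have h2 := congrArg abs (hef n)
      rw [abs_mul, abs_mul, abs_of_pos (by positivity : (0 : ℝ) < n + a), abs_of_pos hc] at h2
      rw [div_mul_eq_mul_div, le_div_iff₀ ha, ← h2, mul_comm]
      gcongr
      simp
    rw [← mul_assoc]
    gcongr
  set φ : ℝ → ℝ := fun s ↦ ∑' n, e n * s ^ n with hφ_def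
  set ψ : ℝ → ℝ := fun s ↦ ∑' n, f n * s ^ n with hψ_def
  have hφ (s : ℝ) : HasDerivAt φ (-ψ s) s := by
    refine (hasDerivAt_tsum_mul_pow he s).congr_deriv ?_
    rw [(summable_natCast_mul_mul_pow_pred he s).tsum_eq_zero_add, hψ_def, ← tsum_neg]
    simp [hf_def]
  have hψ (s : ℝ) : HasDerivAt ψ (∑' n : ℕ, (n : ℝ) * f n * s ^ (n - 1)) s :=
    hasDerivAt_tsum_mul_pow hf s
  set ψ' : ℝ → ℝ := fun s ↦ ∑' n : ℕ, (n : ℝ) * f n * s ^ (n - 1)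
  have hode (s : ℝ) : s * ψ' s + a * ψ s = c * φ s := by
    rw [← tsum_mul_left, ← tsum_mul_left, ← tsum_mul_left, ← Summable.tsum_add
      ((summable_natCast_mul_mul_pow_pred hf s).mul_left _) ((summable_mul_pow hf s).mul_left _)]
    congr 1 with n
    rw [← mul_assoc c, ← hef]
    rcases n with _ | n
    · simp
    · rw [Nat.add_sub_cancel, pow_succ]
      ring
  set Φ : PowerSeries ℝ := PowerSeries.mk e
  set Ψ : PowerSeries ℝ := PowerSeries.mk f
  have hΦ0 : PowerSeries.constantCoeff Φ ≠ 0 := by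
    rw [← PowerSeries.coeff_zero_eq_constantCoeff_apply, PowerSeries.coeff_mk]
    simpa [he_def] using hβ0.ne'
  have hΦ' : PowerSeries.derivative ℝ Φ = -Ψ := by
    ext n
    rw [PowerSeries.coeff_derivative, map_neg, PowerSeries.coeff_mk, PowerSeries.coeff_mk]
    simp only [hf_def]
    ring
  have hΨ : PowerSeries.X * PowerSeries.derivative ℝ Ψ + PowerSeries.C a * Ψ =
      PowerSeries.C c * Φ := by
    ext n
    rw [map_add, PowerSeries.coeff_C_mul, PowerSeries.coeff_C_mul, PowerSeries.coeff_mk,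
      PowerSeries.coeff_mk, ← hef]
    rcases n with _ | n
    · simp
    · rw [PowerSeries.coeff_succ_X_mul, PowerSeries.coeff_derivative, PowerSeries.coeff_mk]
      push_cast
      ring
  have hW := riccati_of_linear hΦ0 hΦ' hΨ
  have hP : PowerSeries.derivative ℝ Φ⁻¹ = Ψ * Φ⁻¹ * Φ⁻¹ := by
    rw [PowerSeries.derivative_inv', hΦ']
    ring
  have hPΦ := PowerSeries.inv_mul_cancel Φ hΦ0
  have hWΦ : Ψ * Φ⁻¹ * Φ = Ψ := by rw [mul_assoc, hPΦ, mul_one]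
  set W := Ψ * Φ⁻¹
  set P := Φ⁻¹
  have hW0 := coeff_nonneg_of_riccati ha hc.le hW
  have hPc : PowerSeries.coeff 0 P * β 0 = 1 := by
    simpa [Φ, he_def] using congrArg (PowerSeries.coeff 0) hPΦ
  have hP0 : ∀ n, 0 ≤ PowerSeries.coeff n P := by
    refine coeff_nonneg_of_derivative_eq_mul hW0 ?_ hP
    rw [← PowerSeries.coeff_zero_eq_constantCoeff_apply]
    exact (pos_of_mul_pos_left (by rw [hPc]; exact one_pos) hβ0.le).le
  have hWle (N : ℕ) {s : ℝ} (hs : s ∈ Ioc 0 s₀) :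
      (∑ n ∈ Finset.range (N + 1), PowerSeries.coeff n W * s ^ n) * φ s ≤ ψ s := by
    have hWd := hasDerivAt_sum_range_mul_pow (fun n ↦ PowerSeries.coeff n W) (N + 1)
    refine sub_nonneg.1 (nonneg_of_sub_mul_le_mul_deriv ha (s₀ := s₀)
      (fun s ↦ (hψ s).sub ((hWd s).mul (hφ s)))
      (W := fun s ↦ ∑ n ∈ Finset.range (N + 1), PowerSeries.coeff n W * s ^ n)
      (by fun_prop) (fun s hs ↦ ?_) hs)
    have h1 := sum_range_riccati_le hW0 hW hs.1.le N
    have h2 : ∑ n ∈ Finset.range (N + 1), (n + a) * PowerSeries.coeff n W * s ^ n =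
        s * (∑ n ∈ Finset.range (N + 1), (n : ℝ) * PowerSeries.coeff n W * s ^ (n - 1)) +
          a * ∑ n ∈ Finset.range (N + 1), PowerSeries.coeff n W * s ^ n := by
      rw [Finset.mul_sum, Finset.mul_sum, ← Finset.sum_add_distrib]
      refine Finset.sum_congr rfl fun n _ ↦ ?_
      rcases n with _ | n
      · simp
      · rw [Nat.add_sub_cancel, pow_succ]
        ring
    rw [h2] at h1
    have h3 := mul_le_mul_of_nonneg_right h1 (hpos s ⟨hs.1.le, hs.2.le⟩).le
    have h4 := hode s
    change (_ : ℝ) * φ s ≤ _ * φ s at h3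
    simp only [Pi.sub_apply, Pi.mul_apply]
    linarith
  have hPle (N : ℕ) {s : ℝ} (hs : s ∈ Icc 0 s₀) :
      ∑ n ∈ Finset.range (N + 1), PowerSeries.coeff n P * s ^ n ≤ (φ s)⁻¹ := by
    have hPd := hasDerivAt_sum_range_mul_pow (fun n ↦ PowerSeries.coeff n P) (N + 1)
    have hd (s : ℝ) := (hPd s).mul (hφ s)
    have hanti : AntitoneOn (fun s ↦
        (∑ n ∈ Finset.range (N + 1), PowerSeries.coeff n P * s ^ n) * φ s) (Icc 0 s₀) := by
      refine antitoneOn_of_hasDerivWithinAt_nonpos (convex_Icc 0 s₀)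
        (fun s _ ↦ (hd s).continuousAt.continuousWithinAt)
        (fun s _ ↦ (hd s).hasDerivWithinAt) fun s hs ↦ ?_
      rw [interior_Icc] at hs
      have h1 : ∑ n ∈ Finset.range (N + 1), (n : ℝ) * PowerSeries.coeff n P * s ^ (n - 1) ≤
          (∑ n ∈ Finset.range (N + 1), PowerSeries.coeff n W * s ^ n) *
            ∑ n ∈ Finset.range (N + 1), PowerSeries.coeff n P * s ^ n := by
        refine le_trans ?_ (sum_range_coeff_mul_mul_pow_le hW0 hP0 hs.1.le (N + 1))
        rw [Finset.sum_range_succ', Finset.sum_range_succ, ← hP]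
        have h2 : 0 ≤ PowerSeries.coeff N (PowerSeries.derivative ℝ P) * s ^ N := by
          rw [PowerSeries.coeff_derivative]
          have := hP0 (N + 1)
          have := hs.1
          positivity
        simp only [Nat.add_sub_cancel, PowerSeries.coeff_derivative] at h2 ⊢
        simp only [Nat.cast_zero, zero_mul, add_zero]
        refine le_trans (le_of_eq (Finset.sum_congr rfl fun n _ ↦ ?_)) (le_add_of_nonneg_right h2)
        push_cast
        ring
      have h3 : 0 ≤ ∑ n ∈ Finset.range (N + 1), PowerSeries.coeff n P * s ^ n :=
        Finset.sum_nonneg fun n _ ↦ mul_nonneg (hP0 n) (pow_nonneg hs.1.le n)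
      have h4 := mul_le_mul_of_nonneg_right h1 (hpos s ⟨hs.1.le, hs.2.le⟩).le
      have h5 := mul_le_mul_of_nonneg_right (hWle N ⟨hs.1, hs.2.le⟩) h3
      change (_ : ℝ) * φ s ≤ _ * φ s at h4
      linarith
    have h0 := hanti (left_mem_Icc.2 (hs.1.trans hs.2)) hs hs.1
    have hφ0 : φ 0 = β 0 := by
      rw [hφ_def]
      simp only
      rw [tsum_eq_single 0 (fun n hn ↦ by simp [hn])]
      simp [he_def]
    rw [← one_div, le_div_iff₀ (hpos s hs)]
    refine h0.trans (le_of_eq ?_)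
    simp only [hφ0]
    rw [Finset.sum_range_succ', Finset.sum_eq_zero (fun n _ ↦ by simp)]
    simpa using hPc
  refine ⟨fun n ↦ PowerSeries.coeff n P, hP0, fun s hs ↦ ?_⟩
  have hs1 : Summable fun n ↦ PowerSeries.coeff n P * s ^ n := by
    refine summable_of_sum_range_le (c := (φ s)⁻¹)
      (fun n ↦ mul_nonneg (hP0 n) (pow_nonneg hs.1 n)) fun N ↦ le_trans ?_ (hPle N hs)
    rw [Finset.sum_range_succ]
    linarith [mul_nonneg (hP0 N) (pow_nonneg hs.1 N)]
  have h1 : (∑' n, PowerSeries.coeff n P * s ^ n) * φ s = 1 := by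
    rw [hφ_def]
    simp only
    rw [tsum_mul_tsum_eq_tsum_sum_antidiagonal_of_summable_norm hs1.norm
      (summable_mul_pow he s).norm, tsum_eq_single 0]
    · simpa [he_def] using hPc
    · intro n hn
      have h2 := congrArg (PowerSeries.coeff n) hPΦ
      rw [PowerSeries.coeff_mul, PowerSeries.coeff_one, if_neg hn] at h2
      have h3 := congrArg (· * s ^ n) h2
      simp only [zero_mul, Finset.sum_mul] at h3
      rw [← h3]
      refine Finset.sum_congr rfl fun p hp ↦ ?_
      rw [Finset.HasAntidiagonal.mem_antidiagonal] at hp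
      rw [PowerSeries.coeff_mk, ← hp, pow_add]
      ring
  have h2 : (φ s)⁻¹ = ∑' n, PowerSeries.coeff n P * s ^ n :=
    (eq_inv_of_mul_eq_one_left h1).symm
  rw [h2]
  exact hs1.hasSum

end ReciprocalSeries

section BallMoments

variable {E : Type*} [NormedAddCommGroup E] [InnerProductSpace ℝ E] [FiniteDimensional ℝ E]
  [MeasurableSpace E] [BorelSpace E]

lemma hasSum_integral_closedBall_cos (α : ℝ) (t : E) :
    HasSum (fun n : ℕ ↦ (-1) ^ n * ((2 * π) ^ (2 * n) / (2 * n).factorial *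
        ∫ x in Metric.closedBall (0 : E) α, ⟪x, t⟫ ^ (2 * n)))
      (∫ x in Metric.closedBall (0 : E) α, Real.cos (2 * π * ⟪x, t⟫)) := by
  have hfin : volume (Metric.closedBall (0 : E) α) < ⊤ := measure_closedBall_lt_top
  have hbound (n : ℕ) : ∀ x ∈ Metric.closedBall (0 : E) α,
      ‖(-1) ^ n * (2 * π * ⟪x, t⟫) ^ (2 * n) / (2 * n).factorial‖ ≤
        (2 * π * (α * ‖t‖)) ^ (2 * n) / (2 * n).factorial := by
    intro x hx
    rw [mem_closedBall_zero_iff] at hx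
    have h1 : ‖⟪x, t⟫‖ ≤ α * ‖t‖ := (norm_inner_le_norm x t).trans (by gcongr)
    rw [norm_div, norm_mul, norm_pow, norm_pow, norm_mul, Real.norm_natCast, norm_neg, norm_one,
      one_pow, one_mul, Real.norm_of_nonneg (by positivity : (0 : ℝ) ≤ 2 * π)]
    gcongr
  have hint (n : ℕ) : IntegrableOn
      (fun x : E ↦ (-1) ^ n * (2 * π * ⟪x, t⟫) ^ (2 * n) / (2 * n).factorial)
      (Metric.closedBall 0 α) :=
    (Continuous.continuousOn (by fun_prop)).integrableOn_compact (isCompact_closedBall 0 α)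
  have h := hasSum_integral_of_summable_integral_norm hint ?_
  · have h1 (x : E) : ∑' n : ℕ, (-1) ^ n * (2 * π * ⟪x, t⟫) ^ (2 * n) / (2 * n).factorial =
        Real.cos (2 * π * ⟪x, t⟫) := (Real.hasSum_cos _).tsum_eq
    simp only [h1] at h
    refine h.congr_fun fun n ↦ ?_
    rw [← integral_const_mul, ← integral_const_mul]
    refine integral_congr_ae (.of_forall fun x ↦ ?_)
    simp only [mul_pow _ ⟪x, t⟫]
    ring
  · refine Summable.of_nonneg_of_le (fun n ↦ integral_nonneg fun x ↦ norm_nonneg _) (fun n ↦ ?_)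
      ((Real.hasSum_cosh (2 * π * (α * ‖t‖))).summable.mul_right
        (volume.real (Metric.closedBall (0 : E) α)))
    refine (Real.le_norm_self _).trans
      (norm_setIntegral_le_of_norm_le_const hfin fun x hx ↦ ?_)
    rw [norm_norm]
    exact hbound n x hx

variable [Nontrivial E]

lemma integral_inner_pow_mul_fun_norm (t : E) (m : ℕ) (h : ℝ → ℝ) :
    ∫ x : E, ⟪x, t⟫ ^ m * h ‖x‖ =
      (∫ ω : Metric.sphere (0 : E) 1, ⟪(ω : E), t⟫ ^ m ∂(volume : Measure E).toSphere) *
        ∫ r in Ioi (0 : ℝ), r ^ (Module.finrank ℝ E - 1) * (r ^ m * h r) :=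
  calc
    ∫ x : E, ⟪x, t⟫ ^ m * h ‖x‖ =
        ∫ x : ({(0)}ᶜ : Set E), ⟪(x : E), t⟫ ^ m * h ‖x.1‖ ∂(volume.comap Subtype.val) := by
      rw [integral_subtype_comap (measurableSet_singleton _).compl
        fun x ↦ ⟪x, t⟫ ^ m * h ‖x‖, restrict_compl_singleton]
    _ = ∫ x : Metric.sphere (0 : E) 1 × Ioi (0 : ℝ),
          ⟪(x.1 : E), t⟫ ^ m * ((x.2 : ℝ) ^ m * h x.2)
            ∂(volume : Measure E).toSphere.prod
              (Measure.volumeIoiPow (Module.finrank ℝ E - 1)) := by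
      rw [← (volume : Measure E).measurePreserving_homeomorphUnitSphereProd.integral_comp
        (Homeomorph.measurableEmbedding _)]
      refine integral_congr_ae (.of_forall fun x ↦ ?_)
      have hx : ‖(x : E)‖ ≠ 0 := norm_ne_zero_iff.2 x.2
      simp only [homeomorphUnitSphereProd_apply_fst_coe, homeomorphUnitSphereProd_apply_snd_coe,
        real_inner_smul_left]
      rw [← mul_assoc, ← mul_pow, mul_right_comm, inv_mul_cancel₀ hx, one_mul]
    _ = (∫ ω : Metric.sphere (0 : E) 1, ⟪(ω : E), t⟫ ^ m ∂(volume : Measure E).toSphere) *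
          ∫ r : Ioi (0 : ℝ), (r : ℝ) ^ m * h r
            ∂Measure.volumeIoiPow (Module.finrank ℝ E - 1) :=
      integral_prod_mul (fun ω : Metric.sphere (0 : E) 1 ↦ ⟪(ω : E), t⟫ ^ m)
        (fun r : Ioi (0 : ℝ) ↦ (r : ℝ) ^ m * h r)
    _ = _ := by
      simp only [Measure.volumeIoiPow, ENNReal.ofReal]
      rw [integral_withDensity_eq_integral_smul,
        integral_subtype_comap measurableSet_Ioi
          fun a ↦ Real.toNNReal (a ^ (Module.finrank ℝ E - 1)) • (a ^ m * h a),
        setIntegral_congr_fun measurableSet_Ioi fun x hx ↦ ?_]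
      · rw [NNReal.smul_def, Real.coe_toNNReal _ (pow_nonneg hx.out.le _), smul_eq_mul]
      · exact (measurable_subtype_coe.pow_const _).real_toNNReal

lemma integrable_inner_pow_mul_exp (t : E) (m : ℕ) :
    Integrable fun x : E ↦ ⟪x, t⟫ ^ m * rexp (-‖x‖ ^ 2) := by
  have h1 : Integrable fun x : E ↦ (‖x‖ ^ m * rexp (-‖x‖ ^ 2)) * ‖t‖ ^ m := by
    refine Integrable.mul_const ?_ _
    refine (integrable_fun_norm_addHaar (volume : Measure E)
      (f := fun r ↦ r ^ m * rexp (-r ^ 2))).2 ?_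
    refine (integrableOn_rpow_mul_exp_neg_rpow (p := 2)
      (s := ((Module.finrank ℝ E - 1 + m : ℕ) : ℝ)) ?_ (by norm_num)).congr_fun
      (fun r _ ↦ ?_) measurableSet_Ioi
    · have : (0 : ℝ) ≤ ((Module.finrank ℝ E - 1 + m : ℕ) : ℝ) := Nat.cast_nonneg _
      linarith
    · simp only [smul_eq_mul]
      rw [Real.rpow_natCast, Real.rpow_two, pow_add, mul_assoc]
  refine h1.mono' (by fun_prop) (.of_forall fun x ↦ ?_)
  rw [norm_mul, norm_pow, Real.norm_of_nonneg (Real.exp_pos _).le, mul_right_comm, ← mul_pow]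
  gcongr
  exact norm_inner_le_norm x t

lemma integral_inner_pow_add_two_mul_exp (t : E) (m : ℕ) :
    ∫ x : E, ⟪x, t⟫ ^ (m + 2) * rexp (-‖x‖ ^ 2) =
      (m + 1) / 2 * ‖t‖ ^ 2 * ∫ x : E, ⟪x, t⟫ ^ m * rexp (-‖x‖ ^ 2) := by
  have hf (x : E) : HasFDerivAt (fun x : E ↦ ⟪x, t⟫ ^ (m + 1))
      (((m + 1 : ℕ) * ⟪x, t⟫ ^ m) • (innerSL ℝ t)) x := by
    have := ((innerSL ℝ t).hasFDerivAt (x := x)).pow (m + 1)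
    simpa [real_inner_comm] using this
  have hg (x : E) : HasFDerivAt (fun x : E ↦ rexp (-‖x‖ ^ 2))
      (rexp (-‖x‖ ^ 2) • (-((2 : ℕ) • innerSL ℝ x) : E →L[ℝ] ℝ)) x :=
    ((hasStrictFDerivAt_norm_sq x).hasFDerivAt.neg).exp
  have hf' (x : E) : fderiv ℝ (fun x : E ↦ ⟪x, t⟫ ^ (m + 1)) x t =
      (m + 1) * ‖t‖ ^ 2 * ⟪x, t⟫ ^ m := by
    rw [(hf x).fderiv]
    simp
    ring
  have hg' (x : E) : fderiv ℝ (fun x : E ↦ rexp (-‖x‖ ^ 2)) x t =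
      -2 * (⟪x, t⟫ * rexp (-‖x‖ ^ 2)) := by
    rw [(hg x).fderiv]
    simp
    ring
  have h := integral_mul_fderiv_eq_neg_fderiv_mul_of_integrable (μ := (volume : Measure E))
    (f := fun x : E ↦ ⟪x, t⟫ ^ (m + 1)) (g := fun x : E ↦ rexp (-‖x‖ ^ 2)) (v := t) ?_ ?_
    (integrable_inner_pow_mul_exp t (m + 1)) (fun x _ ↦ (hf x).differentiableAt)
    (fun x _ ↦ (hg x).differentiableAt)
  · have h1 (x : E) : ⟪x, t⟫ ^ (m + 1) * (-2 * (⟪x, t⟫ * rexp (-‖x‖ ^ 2))) =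
        -2 * (⟪x, t⟫ ^ (m + 2) * rexp (-‖x‖ ^ 2)) := by ring
    simp only [hf', hg', h1, mul_assoc, integral_const_mul] at h
    linarith
  · simp only [hf', mul_assoc]
    exact ((integrable_inner_pow_mul_exp t m).const_mul _).const_mul _
  · simp only [hg']
    refine ((integrable_inner_pow_mul_exp t (m + 2)).const_mul (-2)).congr (.of_forall fun x ↦ ?_)
    ring

lemma integral_sphere_inner_pow_add_two (t : E) (m : ℕ) :
    (Module.finrank ℝ E + m : ℝ) *
        ∫ ω : Metric.sphere (0 : E) 1, ⟪(ω : E), t⟫ ^ (m + 2) ∂(volume : Measure E).toSphere =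
      (m + 1) * ‖t‖ ^ 2 *
        ∫ ω : Metric.sphere (0 : E) 1, ⟪(ω : E), t⟫ ^ m ∂(volume : Measure E).toSphere := by
  have hd : 1 ≤ Module.finrank ℝ E := Module.finrank_pos
  have hd' : (0 : ℝ) < Module.finrank ℝ E := by exact_mod_cast hd
  have hg (k : ℕ) : ∫ r in Ioi (0 : ℝ), r ^ (Module.finrank ℝ E - 1) * (r ^ k * rexp (-r ^ 2)) =
      1 / 2 * Real.Gamma ((Module.finrank ℝ E + k) / 2) := by
    have h1 := integral_rpow_mul_exp_neg_rpow (p := 2) (q := ((Module.finrank ℝ E - 1 + k : ℕ) : ℝ))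
      (by norm_num)
      (by have : (0 : ℝ) ≤ ((Module.finrank ℝ E - 1 + k : ℕ) : ℝ) := Nat.cast_nonneg _
          linarith)
    have h2 : ((Module.finrank ℝ E - 1 + k : ℕ) : ℝ) + 1 = Module.finrank ℝ E + k := by
      push_cast [Nat.cast_sub hd]
      ring
    rw [h2] at h1
    rw [← h1]
    refine setIntegral_congr_fun measurableSet_Ioi fun r _ ↦ ?_
    rw [Real.rpow_natCast, Real.rpow_two, pow_add, mul_assoc]
  have h := integral_inner_pow_add_two_mul_exp t m
  have hp (k : ℕ) := integral_inner_pow_mul_fun_norm t k fun r ↦ rexp (-r ^ 2)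
  rw [hp, hp, hg, hg] at h
  have hpos : 0 < (Module.finrank ℝ E + m : ℝ) / 2 := by positivity
  have h3 : ((Module.finrank ℝ E : ℝ) + (m + 2 : ℕ)) / 2 = (Module.finrank ℝ E + m : ℝ) / 2 + 1 := by
    push_cast
    ring
  rw [h3, Real.Gamma_add_one hpos.ne'] at h
  have hG := Real.Gamma_pos_of_pos hpos
  refine mul_right_cancel₀ hG.ne' ?_
  linear_combination 4 * h

lemma finrank_add_mul_integral_closedBall_inner_pow {α : ℝ} (hα : 0 < α) (t : E) (m : ℕ) :
    (Module.finrank ℝ E + m : ℝ) * ∫ x in Metric.closedBall (0 : E) α, ⟪x, t⟫ ^ m =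
      (∫ ω : Metric.sphere (0 : E) 1, ⟪(ω : E), t⟫ ^ m ∂(volume : Measure E).toSphere) *
        α ^ (Module.finrank ℝ E + m) := by
  have hd : 1 ≤ Module.finrank ℝ E := Module.finrank_pos
  have hd' : (0 : ℝ) < Module.finrank ℝ E := by exact_mod_cast hd
  have h1 : ∫ x in Metric.closedBall (0 : E) α, ⟪x, t⟫ ^ m =
      ∫ x : E, ⟪x, t⟫ ^ m * (Iic α).indicator 1 ‖x‖ := by
    rw [← integral_indicator Metric.isClosed_closedBall.measurableSet]
    refine integral_congr_ae (.of_forall fun x ↦ ?_)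
    by_cases hx : ‖x‖ ≤ α <;> simp [indicator, hx]
  have h2 : ∫ r in Ioi (0 : ℝ), r ^ (Module.finrank ℝ E - 1) * (r ^ m * (Iic α).indicator 1 r) =
      α ^ (Module.finrank ℝ E + m) / (Module.finrank ℝ E + m) := by
    have h3 : ∀ r : ℝ, r ^ (Module.finrank ℝ E - 1) * (r ^ m * (Iic α).indicator 1 r) =
        (Iic α).indicator (fun r ↦ r ^ (Module.finrank ℝ E - 1 + m)) r := by
      intro r
      by_cases hr : r ≤ α <;> simp [indicator, hr, pow_add]
    simp only [h3]
    rw [setIntegral_indicator measurableSet_Iic, Ioi_inter_Iic,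
      ← intervalIntegral.integral_of_le hα.le, integral_pow]
    have h4 : Module.finrank ℝ E - 1 + m + 1 = Module.finrank ℝ E + m := by omega
    rw [h4, zero_pow (by omega), sub_zero]
    congr 1
    rw [← Nat.cast_add_one, h4, Nat.cast_add]
  rw [h1, integral_inner_pow_mul_fun_norm, h2]
  have : (Module.finrank ℝ E + m : ℝ) ≠ 0 := by positivity
  field_simp

lemma integral_closedBall_inner_pow_add_two {α : ℝ} (hα : 0 < α) (t : E) (m : ℕ) :
    (Module.finrank ℝ E + m + 2 : ℝ) * ∫ x in Metric.closedBall (0 : E) α, ⟪x, t⟫ ^ (m + 2) =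
      (m + 1) * α ^ 2 * ‖t‖ ^ 2 * ∫ x in Metric.closedBall (0 : E) α, ⟪x, t⟫ ^ m := by
  have hd' : (0 : ℝ) < Module.finrank ℝ E := by exact_mod_cast Module.finrank_pos
  have h0 := finrank_add_mul_integral_closedBall_inner_pow hα t m
  have h2 := finrank_add_mul_integral_closedBall_inner_pow hα t (m + 2)
  have hs := integral_sphere_inner_pow_add_two t m
  have hne : (Module.finrank ℝ E + m : ℝ) ≠ 0 := by positivity
  refine mul_left_cancel₀ hne ?_
  rw [← add_assoc (Module.finrank ℝ E), pow_add] at h2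
  push_cast at h2
  linear_combination (Module.finrank ℝ E + m : ℝ) * h2 +
    α ^ (Module.finrank ℝ E + m) * α ^ 2 * hs - (m + 1) * α ^ 2 * ‖t‖ ^ 2 * h0

/-- The radial power series of the Fourier transform of the indicator of a ball, with the
recurrence of the Bessel function of order `d / 2`. -/
lemma exists_integral_closedBall_cos_eq_tsum {α : ℝ} (hα : 0 < α) :
    ∃ β : ℕ → ℝ, 0 < β 0 ∧
      (∀ n : ℕ, (n + 1) * (n + (Module.finrank ℝ E / 2 + 1)) * β (n + 1) = (π * α) ^ 2 * β n) ∧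
      ∀ t : E, ∫ x in Metric.closedBall (0 : E) α, Real.cos (2 * π * ⟪x, t⟫) =
        ∑' n, (-1) ^ n * β n * (‖t‖ ^ 2) ^ n := by
  let β : ℕ → ℝ := fun n ↦ Nat.rec (volume.real (Metric.closedBall (0 : E) α))
    (fun n b ↦ (π * α) ^ 2 * b / ((n + 1) * (n + (Module.finrank ℝ E / 2 + 1)))) n
  have hβ (n : ℕ) :
      (n + 1) * (n + (Module.finrank ℝ E / 2 + 1)) * β (n + 1) = (π * α) ^ 2 * β n :=
    mul_div_cancel₀ _ (by positivity)
  refine ⟨β, ?_, hβ, fun t ↦ ?_⟩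
  · exact ENNReal.toReal_pos (Metric.measure_closedBall_pos _ _ hα).ne'
      measure_closedBall_lt_top.ne
  · rw [← (hasSum_integral_closedBall_cos α t).tsum_eq]
    congr 1 with n
    rw [mul_assoc]
    congr 1
    induction n with
    | zero => simp [β]
    | succ n ih =>
      have h1 := integral_closedBall_inner_pow_add_two hα t (2 * n)
      have h2 : ((2 * (n + 1)).factorial : ℝ) = (2 * n + 2) * ((2 * n + 1) * (2 * n).factorial) := by
        rw [show 2 * (n + 1) = 2 * n + 1 + 1 by ring, Nat.factorial_succ, Nat.factorial_succ]
        push_cast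
        ring
      rw [show 2 * (n + 1) = 2 * n + 2 by ring] at h2
      have h3 : (0 : ℝ) < (2 * n).factorial := by exact_mod_cast Nat.factorial_pos _
      have h4 : (0 : ℝ) < (n + 1) * (n + (Module.finrank ℝ E / 2 + 1)) := by positivity
      refine mul_left_cancel₀ h4.ne' ?_
      have h5 : (π * α) ^ 2 * β n * (‖t‖ ^ 2) ^ (n + 1) =
          (π * α) ^ 2 * ‖t‖ ^ 2 * (β n * (‖t‖ ^ 2) ^ n) := by ring
      rw [← mul_assoc _ (β (n + 1)), hβ, h5, ← ih, show 2 * (n + 1) = 2 * n + 2 by ring, h2]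
      push_cast at h1
      rw [pow_add (2 * π)]
      field_simp
      linear_combination h1

end BallMoments

section ExponentialSums

variable {E : Type*} [NormedAddCommGroup E] [InnerProductSpace ℝ E] {T : Set E}

/-- On the set `T`, the function `f` is an absolutely convergent sum of exponentials
`t ↦ c * exp (-2πi⟪y, t⟫)` whose coefficients have total mass at most `C`. -/
def IsExpSumOn (T : Set E) (f : E → ℂ) (C : ℝ) : Prop :=
  ∃ (ι : Type) (_ : Countable ι) (c : ι → ℂ) (y : ι → E),
    Summable (fun j ↦ ‖c j‖) ∧ ∑' j, ‖c j‖ ≤ C ∧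
      ∀ t ∈ T, HasSum (fun j ↦ c j * (𝐞 (-⟪y j, t⟫) : ℂ)) (f t)

lemma isExpSumOn_exp (c : ℂ) (y : E) : IsExpSumOn T (fun t ↦ c * (𝐞 (-⟪y, t⟫) : ℂ)) ‖c‖ :=
  ⟨Unit, inferInstance, fun _ ↦ c, fun _ ↦ y, (hasSum_fintype _).summable, by simp,
    fun t _ ↦ hasSum_unique fun _ : Unit ↦ c * (𝐞 (-⟪y, t⟫) : ℂ)⟩

lemma isExpSumOn_const (c : ℂ) : IsExpSumOn T (fun _ ↦ c) ‖c‖ := by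
  simpa using isExpSumOn_exp (T := T) c 0

lemma IsExpSumOn.hasSum {κ : Type} [Countable κ] {F : κ → E → ℂ} {C : κ → ℝ} {f : E → ℂ} {S : ℝ}
    (hF : ∀ k, IsExpSumOn T (F k) (C k)) (hC : HasSum C S)
    (hf : ∀ t ∈ T, HasSum (fun k ↦ F k t) (f t)) : IsExpSumOn T f S := by
  choose ι hι c y hs hle hsum using hF
  have hnonneg (k : κ) : 0 ≤ ∑' j, ‖c k j‖ := tsum_nonneg fun j ↦ norm_nonneg _
  have hs' : Summable fun k ↦ ∑' j, ‖c k j‖ := Summable.of_nonneg_of_le hnonneg hle hC.summable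
  have hsig : Summable fun p : Σ k, ι k ↦ ‖c p.1 p.2‖ :=
    (summable_sigma_of_nonneg fun _ ↦ norm_nonneg _).2 ⟨hs, hs'⟩
  refine ⟨Σ k, ι k, inferInstance, fun p ↦ c p.1 p.2, fun p ↦ y p.1 p.2, hsig, ?_, fun t ht ↦ ?_⟩
  · rw [hsig.tsum_sigma]
    exact hasSum_le hle hs'.hasSum hC
  · refine (hf t ht).sigma_of_hasSum (fun k ↦ hsum k t ht) (.of_norm ?_)
    simpa only [norm_mul, Circle.norm_coe, mul_one] using hsig

lemma IsExpSumOn.add {f g : E → ℂ} {C D : ℝ} (hf : IsExpSumOn T f C) (hg : IsExpSumOn T g D) :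
    IsExpSumOn T (fun t ↦ f t + g t) (C + D) :=
  IsExpSumOn.hasSum (F := fun b ↦ bif b then f else g) (C := fun b ↦ bif b then C else D)
    (fun b ↦ match b with | true => hf | false => hg)
    (by simpa using hasSum_fintype fun b ↦ bif b then C else D)
    fun t _ ↦ by simpa using hasSum_fintype fun b ↦ (bif b then f else g) t

lemma IsExpSumOn.exp_mul {g : E → ℂ} {C : ℝ} (hg : IsExpSumOn T g C) (c : ℂ) (y : E) :
    IsExpSumOn T (fun t ↦ c * (𝐞 (-⟪y, t⟫) : ℂ) * g t) (‖c‖ * C) := by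
  obtain ⟨ι, hι, b, z, hs, hle, hsum⟩ := hg
  refine ⟨ι, hι, fun j ↦ c * b j, fun j ↦ y + z j, ?_, ?_, fun t ht ↦ ?_⟩
  · simpa using hs.mul_left ‖c‖
  · simp only [norm_mul, tsum_mul_left]
    gcongr
  · refine ((hsum t ht).mul_left (c * (𝐞 (-⟪y, t⟫) : ℂ))).congr_fun fun j ↦ ?_
    rw [inner_add_left, neg_add, AddChar.map_add_eq_mul, Circle.coe_mul]
    ring

lemma IsExpSumOn.mono {f : E → ℂ} {C D : ℝ} (hf : IsExpSumOn T f C) (h : C ≤ D) :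
    IsExpSumOn T f D := by
  obtain ⟨ι, hι, b, z, hs, hle, hsum⟩ := hf
  exact ⟨ι, hι, b, z, hs, hle.trans h, hsum⟩

lemma IsExpSumOn.mul {f g : E → ℂ} {C D : ℝ} (hf : IsExpSumOn T f C) (hg : IsExpSumOn T g D) :
    IsExpSumOn T (fun t ↦ f t * g t) (C * D) := by
  have hD : 0 ≤ D := by
    obtain ⟨ι, hι, b, z, hs, hle, hsum⟩ := hg
    exact (tsum_nonneg fun j ↦ norm_nonneg _).trans hle
  obtain ⟨ι, hι, c, y, hs, hle, hsum⟩ := hf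
  exact (IsExpSumOn.hasSum (fun j ↦ hg.exp_mul (c j) (y j)) (hs.hasSum.mul_right D)
    fun t ht ↦ (hsum t ht).mul_right (g t)).mono (by gcongr)

lemma IsExpSumOn.pow {f : E → ℂ} {C : ℝ} (hf : IsExpSumOn T f C) (n : ℕ) :
    IsExpSumOn T (fun t ↦ f t ^ n) (C ^ n) := by
  induction n with
  | zero => simpa using isExpSumOn_const (T := T) 1
  | succ n ih => simpa only [pow_succ] using ih.mul hf

end ExponentialSums

section Cube

variable {d : ℕ} {lam : ℝ}

lemma hasSum_int_sq_eq {s : ℝ} (hlam : 0 < lam) (hs : |s| ≤ lam) :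
    HasSum (fun n : ℤ ↦ ((2 * lam ^ 2 / π ^ 2 * (1 / n ^ 2) : ℝ) : ℂ) * 𝐞 (n / 2) *
      (𝐞 (n / (2 * lam) * s) : ℂ)) (s ^ 2 - lam ^ 2 / 3 : ℝ) := by
  obtain ⟨h1, h2⟩ := abs_le.1 hs
  have hx : (s + lam) / (2 * lam) ∈ Icc (0 : ℝ) 1 :=
    ⟨div_nonneg (by linarith) (by linarith), (div_le_one (by linarith)).2 (by linarith)⟩
  have h := (hasSum_one_div_pow_mul_fourier_mul_bernoulliFun le_rfl hx).mul_left
    ((2 * lam ^ 2 / π ^ 2 : ℝ) : ℂ)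
  have hπ : (π : ℂ) ≠ 0 := Complex.ofReal_ne_zero.2 Real.pi_ne_zero
  have hl : (lam : ℂ) ≠ 0 := Complex.ofReal_ne_zero.2 hlam.ne'
  have hval : ((2 * lam ^ 2 / π ^ 2 : ℝ) : ℂ) * (-(2 * π * Complex.I) ^ 2 / (2).factorial *
      (bernoulliFun 2 ((s + lam) / (2 * lam)) : ℝ)) = (s ^ 2 - lam ^ 2 / 3 : ℝ) := by
    rw [bernoulliFun_two]
    push_cast
    rw [mul_pow, mul_pow, Complex.I_sq]
    field_simp
    simp
    ring
  rw [hval] at h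
  refine h.congr_fun fun n ↦ ?_
  rw [fourier_coe_apply, mul_assoc, ← Circle.coe_mul, ← AddChar.map_add_eq_mul,
    Real.fourierChar_apply]
  push_cast
  rw [mul_assoc]
  congr 3
  field_simp
  ring

lemma hasSum_int_one_div_sq : HasSum (fun n : ℤ ↦ 1 / (n : ℝ) ^ 2) (π ^ 2 / 3) := by
  have h := hasSum_one_div_pow_mul_fourier_mul_bernoulliFun le_rfl
    (left_mem_Icc.2 (zero_le_one' ℝ))
  rw [← Complex.hasSum_ofReal]
  convert h.congr_fun fun n ↦ ?_ using 1
  · simp [mul_pow]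
    ring
  · simp

lemma isExpSumOn_sq_apply (hlam : 0 < lam) (i : Fin d) :
    IsExpSumOn (cube d lam) (fun t ↦ (t i : ℂ) ^ 2) (lam ^ 2) := by
  have h1 : IsExpSumOn (cube d lam) (fun t ↦ ((t i ^ 2 - lam ^ 2 / 3 : ℝ) : ℂ))
      (2 * lam ^ 2 / π ^ 2 * (π ^ 2 / 3)) := by
    refine IsExpSumOn.hasSum (fun n : ℤ ↦ isExpSumOn_exp
      (((2 * lam ^ 2 / π ^ 2 * (1 / n ^ 2) : ℝ) : ℂ) * 𝐞 (n / 2))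
        (EuclideanSpace.single i (-(n / (2 * lam)) : ℝ))) ?_ fun t ht ↦ ?_
    · refine (hasSum_int_one_div_sq.mul_left (2 * lam ^ 2 / π ^ 2)).congr_fun fun n ↦ ?_
      rw [norm_mul, Circle.norm_coe, mul_one, Complex.norm_real, Real.norm_of_nonneg]
      positivity
    · refine (hasSum_int_sq_eq hlam (ht i)).congr_fun fun n ↦ ?_
      simp [EuclideanSpace.inner_single_left, mul_comm]
  have h2 : IsExpSumOn (cube d lam) (fun t ↦ ((lam ^ 2 / 3 : ℝ) : ℂ)) (lam ^ 2 / 3) := by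
    have := isExpSumOn_const (T := cube d lam) ((lam ^ 2 / 3 : ℝ) : ℂ)
    rwa [Complex.norm_real, Real.norm_of_nonneg (by positivity)] at this
  convert h1.add h2 using 1
  · ext t
    push_cast
    ring
  · field_simp
    ring

lemma isExpSumOn_norm_sq_pow (hlam : 0 < lam) (n : ℕ) :
    IsExpSumOn (cube d lam) (fun t ↦ (((‖t‖ ^ 2) ^ n : ℝ) : ℂ)) ((d * lam ^ 2) ^ n) := by
  have h : IsExpSumOn (cube d lam) (fun t ↦ ((‖t‖ ^ 2 : ℝ) : ℂ)) (d * lam ^ 2) := by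
    refine IsExpSumOn.hasSum (fun i ↦ isExpSumOn_sq_apply hlam i) ?_ fun t _ ↦ ?_
    · convert hasSum_fintype fun _ : Fin d ↦ lam ^ 2
      simp
    · rw [EuclideanSpace.norm_sq_eq]
      simpa using hasSum_fintype fun i ↦ (t i : ℂ) ^ 2
  simpa using h.pow n

lemma norm_sq_le_of_mem_cube {t : EuclideanSpace ℝ (Fin d)} (ht : t ∈ cube d lam) :
    ‖t‖ ^ 2 ≤ d * lam ^ 2 := by
  rw [EuclideanSpace.norm_sq_eq]
  calc
    ∑ i, ‖t i‖ ^ 2 ≤ ∑ _ : Fin d, lam ^ 2 :=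
      Finset.sum_le_sum fun i _ ↦ pow_le_pow_left₀ (norm_nonneg _) (ht i) 2
    _ = d * lam ^ 2 := by simp

lemma norm_corner_sq (d : ℕ) (lam : ℝ) : ‖corner d lam‖ ^ 2 = d * lam ^ 2 := by
  rw [EuclideanSpace.norm_sq_eq]
  simp [corner]

lemma isExpSumOn_inv_ghatBall {α : ℝ} (hd : 1 ≤ d) (hlam : 0 < lam) (hα : 0 < α)
    (hpos : ∀ t : EuclideanSpace ℝ (Fin d), ‖t‖ ≤ √d * lam → 0 < ghatBall d α t) :
    IsExpSumOn (cube d lam) (fun t ↦ ((ghatBall d α t)⁻¹ : ℝ)) (ghatBall d α (corner d lam))⁻¹ := by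
  have : NeZero d := ⟨by omega⟩
  obtain ⟨β, hβ0, hβ, hg⟩ :=
    exists_integral_closedBall_cos_eq_tsum (E := EuclideanSpace ℝ (Fin d)) hα
  obtain ⟨p, hp0, hp⟩ := exists_hasSum_inv_of_recurrence (s₀ := d * lam ^ 2)
    (by positivity) (by positivity) hβ0 hβ fun s hs ↦ by
      have hn : ‖corner d √(s / d)‖ ^ 2 = s := by
        rw [norm_corner_sq, Real.sq_sqrt (div_nonneg hs.1 (Nat.cast_nonneg d)),
          mul_div_cancel₀ _ (Nat.cast_ne_zero.2 (NeZero.ne d))]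
      have := hpos (corner d √(s / d)) ?_
      · rwa [ghatBall, hg, hn] at this
      · refine le_of_sq_le_sq ?_ (by positivity)
        rw [hn, mul_pow, Real.sq_sqrt (Nat.cast_nonneg d)]
        exact hs.2
  have hc := hp (d * lam ^ 2) ⟨by positivity, le_rfl⟩
  rw [← norm_corner_sq d lam, ← hg] at hc
  refine IsExpSumOn.hasSum (fun n ↦ (isExpSumOn_const ((p n : ℝ) : ℂ)).mul
    (isExpSumOn_norm_sq_pow hlam n)) (hc.congr_fun fun n ↦ ?_) fun t ht ↦ ?_
  · rw [Complex.norm_real, Real.norm_of_nonneg (hp0 n), norm_corner_sq]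
  · have := hp (‖t‖ ^ 2) ⟨sq_nonneg _, norm_sq_le_of_mem_cube ht⟩
    rw [← hg] at this
    exact_mod_cast Complex.hasSum_ofReal.2 this

end Cube

section FourierInjectivity

variable {V : Type*} [NormedAddCommGroup V] [InnerProductSpace ℝ V] [FiniteDimensional ℝ V]
  [MeasurableSpace V] [BorelSpace V]

lemma integral_fourier_mul_eq_integral_mul_fourier {f g : V → ℂ} (hf : Integrable f)
    (hg : Integrable g) : ∫ x, 𝓕 f x * g x = ∫ x, f x * 𝓕 g x := by
  have h := VectorFourier.integral_fourierIntegral_smul_eq_flip (e := 𝐞) (μ := volume)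
    (ν := volume) (L := innerₗ V) Real.continuous_fourierChar continuous_inner hf hg
  rwa [flip_innerₗ] at h

lemma ae_eq_zero_of_fourier_eq_zero {f : V → ℂ} (hf : Integrable f) (h : ∀ t, 𝓕 f t = 0) :
    ∀ᵐ x, f x = 0 := by
  refine ae_eq_zero_of_integral_contDiff_smul_eq_zero hf.locallyIntegrable
    fun ψ hψ hψc ↦ ?_
  have hc : HasCompactSupport fun x ↦ (ψ x : ℂ) := hψc.comp_left Complex.ofReal_zero
  let φ : SchwartzMap V ℂ := hc.toSchwartzMap (Complex.ofRealCLM.contDiff.comp hψ)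
  have h1 := integral_fourier_mul_eq_integral_mul_fourier hf
    (𝓕⁻ φ : SchwartzMap V ℂ).integrable
  have h2 : 𝓕 (⇑(𝓕⁻ φ : SchwartzMap V ℂ)) = φ := by
    rw [← SchwartzMap.fourier_coe, fourier_fourierInv_eq]
  simp only [h, zero_mul, integral_zero, h2] at h1
  rw [h1]
  refine integral_congr_ae (.of_forall fun x ↦ ?_)
  exact (Complex.real_smul).trans (mul_comm _ _)

lemma integrable_tsum_of_summable_integral_norm {X ι : Type*} [MeasurableSpace X] {μ : Measure X}
    [Countable ι] {F : ι → X → ℂ} (hF : ∀ j, Integrable (F j) μ)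
    (hsum : Summable fun j ↦ ∫ x, ‖F j x‖ ∂μ) : Integrable (fun x ↦ ∑' j, F j x) μ := by
  refine ⟨(AEMeasurable.tsum fun j ↦ (hF j).aemeasurable).aestronglyMeasurable, ?_⟩
  calc
    ∫⁻ x, ‖∑' j, F j x‖ₑ ∂μ ≤ ∫⁻ x, ∑' j, ‖F j x‖ₑ ∂μ :=
      lintegral_mono fun x ↦ enorm_tsum_le_tsum_enorm
    _ = ∑' j, ENNReal.ofReal (∫ x, ‖F j x‖ ∂μ) := by
      rw [lintegral_tsum fun j ↦ (hF j).aestronglyMeasurable.enorm]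
      simp only [ofReal_integral_norm_eq_lintegral_enorm (hF _)]
    _ < ⊤ := hsum.tsum_ofReal_lt_top

lemma fourier_comp_sub_right (f : V → ℂ) (y t : V) :
    𝓕 (fun x ↦ f (x - y)) t = 𝐞 (-⟪y, t⟫) * 𝓕 f t := by
  rw [Real.fourier_eq, Real.fourier_eq,
    ← integral_add_right_eq_self (fun x ↦ 𝐞 (-⟪x, t⟫) • f (x - y)) y, ← integral_const_mul]
  refine integral_congr_ae (.of_forall fun x ↦ ?_)
  simp only [add_sub_cancel_right, inner_add_left, neg_add_rev, AddChar.map_add_eq_mul,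
    Circle.smul_def, Circle.coe_mul, smul_eq_mul, mul_assoc]

/-- Superpositions of translates of an integrable function. -/
lemma hasSum_translate_fourier {ι : Type*} [Countable ι] {c : ι → ℂ} (hc : Summable fun j ↦ ‖c j‖)
    (y : ι → V) {f : V → ℂ} (hf : Integrable f) :
    Integrable (fun x ↦ ∑' j, c j * f (x - y j)) ∧
      ∀ t, HasSum (fun j ↦ c j * (𝐞 (-⟪y j, t⟫) : ℂ) * 𝓕 f t)
        (𝓕 (fun x ↦ ∑' j, c j * f (x - y j)) t) := by
  have hint (j : ι) : Integrable fun x ↦ c j * f (x - y j) := (hf.comp_sub_right _).const_mul _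
  have hnorm (j : ι) : ∫ x, ‖c j * f (x - y j)‖ = ‖c j‖ * ∫ x, ‖f x‖ := by
    simp only [norm_mul, integral_const_mul, integral_sub_right_eq_self fun x ↦ ‖f x‖]
  have hsum : Summable fun j ↦ ∫ x, ‖c j * f (x - y j)‖ := by
    simp only [hnorm]
    exact hc.mul_right _
  refine ⟨integrable_tsum_of_summable_integral_norm hint hsum, fun t ↦ ?_⟩
  · have h := hasSum_integral_of_summable_integral_norm
      (F := fun j x ↦ 𝐞 (-⟪x, t⟫) • (c j * f (x - y j)))
      (fun j ↦ (Real.fourierIntegral_convergent_iff t).2 (hint j)) (by simpa using hsum)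
    have htsum (x : V) : ∑' j, 𝐞 (-⟪x, t⟫) • (c j * f (x - y j)) =
        𝐞 (-⟪x, t⟫) • ∑' j, c j * f (x - y j) := by
      simp only [Circle.smul_def, smul_eq_mul, tsum_mul_left]
    simp only [htsum, ← Real.fourier_eq] at h
    refine h.congr_fun fun j ↦ ?_
    have := fourier_comp_sub_right f (y j) t
    rw [Real.fourier_eq] at this
    rw [mul_assoc, ← this, ← integral_const_mul, Real.fourier_eq]
    refine integral_congr_ae (.of_forall fun x ↦ ?_)
    simp only [Circle.smul_def, smul_eq_mul]
    ring

lemma fourier_indicator_closedBall (α : ℝ) (t : V) :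
    𝓕 ((Metric.closedBall (0 : V) α).indicator fun _ ↦ (1 : ℂ)) t =
      (∫ x in Metric.closedBall (0 : V) α, Real.cos (2 * π * ⟪x, t⟫) : ℝ) := by
  have hB : MeasurableSet (Metric.closedBall (0 : V) α) := Metric.isClosed_closedBall.measurableSet
  let F : V → ℂ := (Metric.closedBall (0 : V) α).indicator fun x ↦ (𝐞 (-⟪x, t⟫) : ℂ)
  have hF : Integrable F := (integrable_indicator_iff hB).2
    ((Continuous.continuousOn (by fun_prop)).integrableOn_compact (isCompact_closedBall 0 α))
  have h1 : 𝓕 ((Metric.closedBall (0 : V) α).indicator fun _ ↦ (1 : ℂ)) t = ∫ x, F x := by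
    rw [Real.fourier_eq]
    refine integral_congr_ae (.of_forall fun x ↦ ?_)
    by_cases hx : x ∈ Metric.closedBall (0 : V) α <;> simp [F, hx, Circle.smul_def]
  have h2 : ∫ x, F x + F (-x) = 2 * ∫ x, F x := by
    rw [integral_add hF hF.comp_neg, integral_neg_eq_self]
    ring
  have h3 (x : V) : F x + F (-x) = 2 * (((Metric.closedBall (0 : V) α).indicator
      fun x ↦ Real.cos (2 * π * ⟪x, t⟫)) x : ℝ) := by
    by_cases hx : ‖x‖ ≤ α
    · simp [F, hx, indicator, Real.fourierChar_apply, Complex.cos]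
      ring_nf
    · simp [F, hx, indicator]
  simp only [h3, integral_const_mul, integral_complex_ofReal, integral_indicator hB] at h2
  rw [h1, ← mul_left_cancel₀ two_ne_zero h2]

end FourierInjectivity

section Concentration

variable {V : Type*} [NormedAddCommGroup V] [InnerProductSpace ℝ V] [FiniteDimensional ℝ V]
  [MeasurableSpace V] [BorelSpace V]

lemma setLIntegral_convolution_indicator_le {G : V → ℂ} (hG : Integrable G) {N : Set V}
    (α : ℝ) {S : ENNReal}
    (hS : ∀ x, volume (N ∩ Metric.closedBall x α) ≤ S) (y : V) :
    ∫⁻ x in N, ‖(convolution G ((Metric.closedBall (0 : V) α).indicator fun _ ↦ (1 : ℂ))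
      (ContinuousLinearMap.mul ℂ ℂ) volume) (x - y)‖ₑ ≤ S * ∫⁻ x, ‖G x‖ₑ := by
  have hB : MeasurableSet (Metric.closedBall (0 : V) α) := Metric.isClosed_closedBall.measurableSet
  have hmem (x z : V) : x - y - z ∈ Metric.closedBall (0 : V) α ↔
      x ∈ Metric.closedBall (y + z) α := by
    rw [mem_closedBall_zero_iff, mem_closedBall_iff_norm, sub_sub]
  have hmeas : AEMeasurable (Function.uncurry fun x z ↦
      ‖G z‖ₑ * (Metric.closedBall (0 : V) α).indicator (fun _ ↦ (1 : ENNReal)) (x - y - z))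
      ((volume.restrict N).prod volume) := by
    refine AEMeasurable.mul ?_ ?_
    · exact hG.aestronglyMeasurable.enorm.comp_snd
    · exact ((measurable_const.indicator hB).comp (by fun_prop)).aemeasurable
  calc
    _ ≤ ∫⁻ x in N, ∫⁻ z, ‖G z‖ₑ *
        (Metric.closedBall (0 : V) α).indicator (fun _ ↦ (1 : ENNReal)) (x - y - z) := by
      refine lintegral_mono fun x ↦ (enorm_integral_le_lintegral_enorm _).trans_eq ?_
      refine lintegral_congr fun z ↦ ?_
      by_cases hz : x - y - z ∈ Metric.closedBall (0 : V) α <;> simp [hz]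
    _ = ∫⁻ z, ∫⁻ x in N, ‖G z‖ₑ *
        (Metric.closedBall (0 : V) α).indicator (fun _ ↦ (1 : ENNReal)) (x - y - z) :=
      lintegral_lintegral_swap hmeas
    _ = ∫⁻ z, ‖G z‖ₑ * volume (N ∩ Metric.closedBall (y + z) α) := by
      refine lintegral_congr fun z ↦ ?_
      have h1 (x : V) : (Metric.closedBall (0 : V) α).indicator (fun _ ↦ (1 : ENNReal)) (x - y - z) =
          (Metric.closedBall (y + z) α).indicator 1 x := by
        by_cases hx : x ∈ Metric.closedBall (y + z) α
        · simp only [indicator_of_mem ((hmem x z).2 hx), indicator_of_mem hx, Pi.one_apply]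
        · rw [indicator_of_notMem (mt (hmem x z).1 hx), indicator_of_notMem hx]
      simp only [h1]
      rw [lintegral_const_mul' _ _ enorm_ne_top,
        lintegral_indicator_one Metric.isClosed_closedBall.measurableSet,
        Measure.restrict_apply Metric.isClosed_closedBall.measurableSet, inter_comm]
    _ ≤ ∫⁻ z, S * ‖G z‖ₑ := lintegral_mono fun z ↦ by
      rw [mul_comm]
      gcongr
      exact hS _
    _ = S * ∫⁻ x, ‖G x‖ₑ := lintegral_const_mul'' _ hG.aestronglyMeasurable.enorm

/-- If the reciprocal of the Fourier transform of the indicator of a ball is an absolutely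
convergent exponential sum of mass `C` on the spectrum of `G`, then `G` is a superposition of
translates of its ball averages, which bounds its concentration on `N`. -/
lemma setLIntegral_enorm_le_of_isExpSumOn {G : V → ℂ} (hG : Integrable G) {T : Set V}
    (hT : ∀ t ∉ T, 𝓕 G t = 0) {α C : ℝ} {g : V → ℝ}
    (hg : ∀ t, ∫ x in Metric.closedBall (0 : V) α, Real.cos (2 * π * ⟪x, t⟫) = g t)
    (hg0 : ∀ t ∈ T, g t ≠ 0) (hC : IsExpSumOn T (fun t ↦ ((g t)⁻¹ : ℝ)) C)
    {N : Set V} {S : ENNReal}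
    (hS : ∀ x, volume (N ∩ Metric.closedBall x α) ≤ S) :
    ∫⁻ x in N, ‖G x‖ₑ ≤ ENNReal.ofReal C * (S * ∫⁻ x, ‖G x‖ₑ) := by
  obtain ⟨ι, _, c, y, hc, hcC, hsum⟩ := hC
  let χ : V → ℂ := (Metric.closedBall (0 : V) α).indicator fun _ ↦ (1 : ℂ)
  have hχ : Integrable χ := (integrable_indicator_iff Metric.isClosed_closedBall.measurableSet).2
    (integrableOn_const measure_closedBall_lt_top.ne)
  let Q : V → ℂ := convolution G χ (ContinuousLinearMap.mul ℂ ℂ) volume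
  have hQ : Integrable Q := hG.integrable_convolution _ hχ
  have hFQ (t : V) : 𝓕 Q t = 𝓕 G t * g t := by
    rw [← hg, ← fourier_indicator_closedBall]
    exact Real.fourier_mul_convolution_eq hG hχ t
  obtain ⟨hK, hFK⟩ := hasSum_translate_fourier hc y hQ
  set K : V → ℂ := fun x ↦ ∑' j, c j * Q (x - y j)
  have hGK (t : V) : 𝓕 K t = 𝓕 G t := by
    refine (hFK t).unique ?_
    by_cases ht : t ∈ T
    · have := (hsum t ht).mul_right (𝓕 Q t)
      have hval : ((g t)⁻¹ : ℝ) * 𝓕 Q t = 𝓕 G t := by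
        rw [hFQ, mul_comm (𝓕 G t), ← mul_assoc, Complex.ofReal_inv,
          inv_mul_cancel₀ (Complex.ofReal_ne_zero.2 (hg0 t ht)), one_mul]
      rwa [hval] at this
    · simp only [hFQ, hT t ht, zero_mul, mul_zero]
      exact hasSum_zero
  have hae : ∀ᵐ x, G x = K x := by
    have h0 : ∀ t, 𝓕 (fun x ↦ G x - K x) t = 0 := fun t ↦ by
      have := hGK t
      rw [Real.fourier_eq] at this ⊢
      rw [Real.fourier_eq] at this
      simp only [smul_sub]
      rw [integral_sub ((Real.fourierIntegral_convergent_iff t).2 hG)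
        ((Real.fourierIntegral_convergent_iff t).2 hK), this, sub_self]
    filter_upwards [ae_eq_zero_of_fourier_eq_zero (hG.sub hK) h0] with x hx
    exact sub_eq_zero.1 hx
  calc
    ∫⁻ x in N, ‖G x‖ₑ = ∫⁻ x in N, ‖K x‖ₑ :=
      lintegral_congr_ae (ae_restrict_of_ae (hae.mono fun x hx ↦ by simp only [hx]))
    _ ≤ ∫⁻ x in N, ∑' j, ‖c j * Q (x - y j)‖ₑ :=
      lintegral_mono fun x ↦ enorm_tsum_le_tsum_enorm
    _ = ∑' j, ∫⁻ x in N, ‖c j * Q (x - y j)‖ₑ := lintegral_tsum fun j ↦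
      ((hQ.comp_sub_right (y j)).const_mul (c j)).aestronglyMeasurable.enorm.restrict
    _ ≤ ∑' j, ‖c j‖ₑ * (S * ∫⁻ x, ‖G x‖ₑ) := by
      refine ENNReal.tsum_le_tsum fun j ↦ ?_
      simp only [enorm_mul]
      rw [lintegral_const_mul' _ _ enorm_ne_top]
      gcongr
      exact setLIntegral_convolution_indicator_le hG α hS (y j)
    _ = ENNReal.ofReal (∑' j, ‖c j‖) * (S * ∫⁻ x, ‖G x‖ₑ) := by
      rw [ENNReal.tsum_mul_right, ENNReal.ofReal_tsum_of_nonneg (fun j ↦ norm_nonneg _) hc]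
      simp only [ofReal_norm]
    _ ≤ _ := by gcongr

end Concentration

theorem concentration_cube_spectrum_ball_window
    (d : ℕ) (hd : 1 ≤ d) (lam α : ℝ) (hlam : 0 < lam) (hα : 0 < α)
    (hpos : ∀ t : EuclideanSpace ℝ (Fin d), ‖t‖ ≤ Real.sqrt d * lam → 0 < ghatBall d α t)
    (N : Set (EuclideanSpace ℝ (Fin d))) (hN : MeasurableSet N)
    (G : EuclideanSpace ℝ (Fin d) → ℂ) (hG : PaleyWienerCube d lam G) :
    ∫ x in N, ‖G x‖ ≤ (ghatBall d α (corner d lam))⁻¹ *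
      (⨆ x : EuclideanSpace ℝ (Fin d), (volume (N ∩ Metric.closedBall x α)).toReal) *
      ∫ x : EuclideanSpace ℝ (Fin d), ‖G x‖ := by
  obtain ⟨hGi, hG0⟩ := hG
  have hle {t : EuclideanSpace ℝ (Fin d)} (ht : ‖t‖ ^ 2 ≤ d * lam ^ 2) : ‖t‖ ≤ √d * lam := by
    refine le_of_sq_le_sq ?_ (by positivity)
    rwa [mul_pow, Real.sq_sqrt (Nat.cast_nonneg d)]
  set S : ℝ := ⨆ x : EuclideanSpace ℝ (Fin d), (volume (N ∩ Metric.closedBall x α)).toReal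
  have hfin (x : EuclideanSpace ℝ (Fin d)) : volume (N ∩ Metric.closedBall x α) ≠ ⊤ :=
    measure_ne_top_of_subset inter_subset_right measure_closedBall_lt_top.ne
  have hbdd : BddAbove (range fun x : EuclideanSpace ℝ (Fin d) ↦
      (volume (N ∩ Metric.closedBall x α)).toReal) := by
    refine ⟨(volume (Metric.closedBall (0 : EuclideanSpace ℝ (Fin d)) α)).toReal, ?_⟩
    rintro _ ⟨x, rfl⟩
    refine ENNReal.toReal_mono measure_closedBall_lt_top.ne ?_
    rw [← Measure.addHaar_closedBall_center volume x]
    exact measure_mono inter_subset_right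
  have hS0 : 0 ≤ S := Real.iSup_nonneg fun x ↦ ENNReal.toReal_nonneg
  have hc : 0 < ghatBall d α (corner d lam) := hpos _ (hle (norm_corner_sq d lam).le)
  have key := setLIntegral_enorm_le_of_isExpSumOn hGi hG0 (fun _ ↦ rfl)
    (fun t ht ↦ (hpos t (hle (norm_sq_le_of_mem_cube ht))).ne')
    (isExpSumOn_inv_ghatBall hd hlam hα hpos) (S := ENNReal.ofReal S)
    fun x ↦ (ENNReal.le_ofReal_iff_toReal_le (hfin x) hS0).2 (le_ciSup hbdd x)
  have hGtop : ∫⁻ x, ‖G x‖ₑ ≠ ⊤ := hGi.2.ne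
  rw [integral_norm_eq_lintegral_enorm hGi.aestronglyMeasurable.restrict,
    integral_norm_eq_lintegral_enorm hGi.aestronglyMeasurable]
  refine (ENNReal.toReal_mono (ENNReal.mul_ne_top ENNReal.ofReal_ne_top
    (ENNReal.mul_ne_top ENNReal.ofReal_ne_top hGtop)) key).trans_eq ?_
  rw [ENNReal.toReal_mul, ENNReal.toReal_mul, ENNReal.toReal_ofReal (inv_pos.2 hc).le,
    ENNReal.toReal_ofReal hS0, mul_assoc]
end

section
/- For every c > 0, every λ > 0, and every integer n, the integral ∫_{-λ}^{λ} e^{c x²} cos(πnx/λ) dx has sign (-1)^n; that is, (-1)^n ∫_{-λ}^{λ} e^{c x²} cos(πnx/λ) dx ≥ 0. -/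
open MeasureTheory Real Set intervalIntegral

/-- If `f` has a nonnegative continuous second derivative, its cosine coefficients on
`[-lam, lam]` alternate in sign. -/
theorem neg_one_zpow_mul_integral_mul_cos_nonneg {f f' f'' : ℝ → ℝ}
    (hf : ∀ x, HasDerivAt f (f' x) x) (hf' : ∀ x, HasDerivAt f' (f'' x) x)
    (hcont : Continuous f'') (hnonneg : ∀ x, 0 ≤ f'' x)
    {lam : ℝ} (hlam : 0 < lam) {n : ℤ} (hn : n ≠ 0) :
    0 ≤ (-1 : ℝ) ^ n * ∫ x in (-lam)..lam, f x * cos (π * n * x / lam) := by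
  set s : ℝ := (-1) ^ n with hs
  set ω : ℝ := π * n / lam with hω
  have hω0 : ω ≠ 0 := by
    have : (n : ℝ) ≠ 0 := by exact_mod_cast hn
    positivity
  have hωlam : ω * lam = n * π := by
    rw [hω]; field_simp
  have hcos : cos (ω * lam) = s := by rw [hωlam, cos_int_mul_pi]
  have hsin : sin (ω * lam) = 0 := by rw [hωlam, sin_int_mul_pi]
  have hss : s * s = 1 := by
    have := sin_sq_add_cos_sq (ω * lam)
    rw [hcos, hsin] at this
    linarith
  have hfc : Continuous f := continuous_iff_continuousAt.2 fun x => (hf x).continuousAt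
  have hderiv : ∀ x, HasDerivAt
      (fun y => f y * (s * ω * sin (ω * y)) - f' y * (1 - s * cos (ω * y)))
      (s * ω ^ 2 * (f x * cos (ω * x)) - f'' x * (1 - s * cos (ω * x))) x := by
    intro x
    have hl : HasDerivAt (fun y => ω * y) ω x := by
      simpa using (hasDerivAt_id x).const_mul ω
    refine (((hf x).mul (hl.sin.const_mul (s * ω))).sub
      ((hf' x).mul ((hl.cos.const_mul s).const_sub 1))).congr_deriv ?_
    ring
  have hint₁ : IntervalIntegrable (fun x => s * ω ^ 2 * (f x * cos (ω * x)))
      volume (-lam) lam := Continuous.intervalIntegrable (by fun_prop) _ _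
  have hint₂ : IntervalIntegrable (fun x => f'' x * (1 - s * cos (ω * x)))
      volume (-lam) lam := Continuous.intervalIntegrable (by fun_prop) _ _
  have key := integral_eq_sub_of_hasDerivAt (fun x _ => hderiv x) (hint₁.sub hint₂)
  rw [integral_sub hint₁ hint₂, intervalIntegral.integral_const_mul] at key
  simp only [mul_neg, sin_neg, cos_neg, hsin, hcos, hss, mul_zero, neg_zero, sub_self] at key
  have hpos : 0 ≤ ∫ x in (-lam)..lam, f'' x * (1 - s * cos (ω * x)) := by
    refine integral_nonneg (by linarith) fun x _ => mul_nonneg (hnonneg x) ?_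
    nlinarith [sq_nonneg (s - cos (ω * x)), cos_sq_le_one (ω * x)]
  have heq : ∀ x, π * n * x / lam = ω * x := fun x => by rw [hω]; ring
  simp only [heq]
  refine nonneg_of_mul_nonneg_right (a := ω ^ 2) ?_ (by positivity)
  linarith

theorem gaussian_type_coefficients_alternate_sign
    (c : ℝ) (hc : 0 < c) (lam : ℝ) (hlam : 0 < lam) (n : ℤ) :
    0 ≤ (-1 : ℝ) ^ n * ∫ x in (-lam)..lam, Real.exp (c * x ^ 2) * Real.cos (π * n * x / lam) := by
  rcases eq_or_ne n 0 with rfl | hn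
  · simpa using integral_nonneg (μ := volume) (by linarith : -lam ≤ lam)
      fun x _ => (exp_pos (c * x ^ 2)).le
  have hexp : ∀ x, HasDerivAt (fun y => exp (c * y ^ 2)) (exp (c * x ^ 2) * (2 * c * x)) x := by
    intro x
    refine ((hasDerivAt_pow 2 x).const_mul c).exp.congr_deriv ?_
    push_cast
    ring
  refine neg_one_zpow_mul_integral_mul_cos_nonneg hexp
    (f'' := fun x => exp (c * x ^ 2) * (2 * c * x) ^ 2 + exp (c * x ^ 2) * (2 * c))
    (fun x => ?_) (by fun_prop) (fun x => by positivity) hlam hn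
  refine ((hexp x).mul ((hasDerivAt_id x).const_mul (2 * c))).congr_deriv ?_
  simp only [id]
  ring
end
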